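/- Let X ⊆ 𝒜^∞ be an infinite strictly ergodic shift space (minimal with a unique σ-invariant measure ν) which is d̄_M-stable. Then for every sequence (μ_n)_{n≥1} in which μ_n is an ergodic measure supported on a single periodic orbit contained in the Markov approximation X^M_n, one has d̄_M(μ_n, ν) → 0 as n → ∞. -/

import Mathlib

open MeasureTheory Filter Topology

namespace DbarPaper

variable {A : Type} [Fintype A] [DecidableEq A] [Inhabited A]
  [TopologicalSpace A] [DiscreteTopology A]
  [MeasurableSpace A] [MeasurableSingletonClass A]

/-- The shift map on the full shift `𝒜^∞ = ℕ → A`. -/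
def shift : (ℕ → A) → (ℕ → A) := fun x n => x (n + 1)

/-- A shift space: a nonempty, closed, shift-invariant subset of the full shift. -/
def ShiftSpace (X : Set (ℕ → A)) : Prop :=
  X.Nonempty ∧ IsClosed X ∧ ∀ x ∈ X, shift x ∈ X

/-- The word `w` appears in the sequence `x`. -/
def occursIn (w : List A) (x : ℕ → A) : Prop :=
  ∃ i : ℕ, w = List.ofFn (fun k : Fin w.length => x (i + (k : ℕ)))

/-- The language of a set `X`: all finite words appearing in points of `X`. -/
def lang (X : Set (ℕ → A)) : Set (List A) := {w | ∃ x ∈ X, occursIn w x}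

/-- Words of length `n` in the language of `X`. -/
def langN (n : ℕ) (X : Set (ℕ → A)) : Set (List A) := {w | w ∈ lang X ∧ w.length = n}

/-- The pseudometric `d̄` on the full shift. -/
noncomputable def dbar (x y : ℕ → A) : ℝ :=
  Filter.limsup
    (fun n => (((Finset.range n).filter (fun j => x j ≠ y j)).card : ℝ) / (n : ℝ))
    Filter.atTop

/-- Hausdorff "distance" between two sets induced by a `ℝ`-valued distance. -/
noncomputable def hausdist {Z : Type*} (d : Z → Z → ℝ) (P Q : Set Z) : ℝ :=
  max (⨆ p : P, ⨅ q : Q, d p q) (⨆ q : Q, ⨅ p : P, d p q)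

/-- A probability measure is shift-invariant. -/
def invariantPM (μ : ProbabilityMeasure (ℕ → A)) : Prop :=
  (μ : Measure (ℕ → A)).map shift = (μ : Measure (ℕ → A))

/-- `M_σ(X)`: shift-invariant Borel probability measures giving `X` full measure. -/
def Msigma (X : Set (ℕ → A)) : Set (ProbabilityMeasure (ℕ → A)) :=
  {μ | invariantPM μ ∧ μ X = 1}

/-- `ξ` is a joining of `μ` and `ν`: a `σ×σ`-invariant measure on the product with
marginals `μ` and `ν`. -/
def IsJoining (ξ : Measure ((ℕ → A) × (ℕ → A))) (μ ν : ProbabilityMeasure (ℕ → A)) : Prop :=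
  ξ.map (Prod.map shift shift) = ξ ∧
  ξ.map Prod.fst = (μ : Measure (ℕ → A)) ∧ ξ.map Prod.snd = (ν : Measure (ℕ → A))

/-- Ornstein's metric `d̄_M` on invariant measures. -/
noncomputable def dbarM (μ ν : ProbabilityMeasure (ℕ → A)) : ℝ :=
  sInf {r : ℝ | ∃ ξ : Measure ((ℕ → A) × (ℕ → A)),
    IsJoining ξ μ ν ∧ r = (ξ {p | p.1 0 ≠ p.2 0}).toReal}

/-- `d̄_M`-stability of a shift space (Austin). -/
def DbarMStable (X : Set (ℕ → A)) : Prop :=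
  ∀ ε : ℝ, 0 < ε → ∃ U : Set (ProbabilityMeasure (ℕ → A)), IsOpen U ∧ Msigma X ⊆ U ∧
    ∀ ν ∈ U, invariantPM ν → ∃ μ ∈ Msigma X, dbarM μ ν < ε

/-- The infinite concatenation of a sequence of (nonempty) words. -/
def concatSeq (w : ℕ → List A) : ℕ → A := fun n =>
  ((List.ofFn (fun i : Fin (n + 1) => w (i : ℕ))).flatten).getD n default

/-- The `d̄`-shadowing property. -/
def DbarShadowing (X : Set (ℕ → A)) : Prop :=
  ∀ ε : ℝ, 0 < ε → ∃ N : ℕ, 0 < N ∧ ∀ w : ℕ → List A,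
    (∀ j, w j ∈ lang X) → (∀ j, N ≤ (w j).length) →
    ∃ x' ∈ X, dbar (concatSeq w) x' < ε

/-- `U_n(X)`: the union of cylinders of words of length `n` in the language of `X`. -/
def cylNbhd (X : Set (ℕ → A)) (n : ℕ) : Set (ℕ → A) :=
  {x | List.ofFn (fun k : Fin n => x (k : ℕ)) ∈ lang X}

/-- The `n`-th (topological) Markov approximation of `X`: all sequences whose subwords of
length `n+1` belong to the language of `X`. -/
def markovApprox (X : Set (ℕ → A)) (n : ℕ) : Set (ℕ → A) :=
  {x | ∀ i : ℕ, List.ofFn (fun k : Fin (n + 1) => x (i + (k : ℕ))) ∈ lang X}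

/-- Transitivity, in terms of the language. -/
def TransitiveShift (X : Set (ℕ → A)) : Prop :=
  ∀ u ∈ lang X, ∀ w ∈ lang X, ∃ v : List A, u ++ v ++ w ∈ lang X

/-- Topological mixing, in terms of the language. -/
def MixingShift (X : Set (ℕ → A)) : Prop :=
  ∀ u ∈ lang X, ∀ w ∈ lang X, ∃ N : ℕ, ∀ m : ℕ, N ≤ m →
    ∃ v : List A, v.length = m ∧ u ++ v ++ w ∈ lang X

/-- Chain mixing: all but finitely many Markov approximations are topologically mixing. -/
def ChainMixing (X : Set (ℕ → A)) : Prop :=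
  ∃ N : ℕ, ∀ n : ℕ, N ≤ n → MixingShift (markovApprox X n)

/-- `C` is the measure center of `X`: the smallest shift space contained in `X` of full
measure for every invariant measure of `X`. -/
def IsMeasureCenter (X C : Set (ℕ → A)) : Prop :=
  ShiftSpace C ∧ C ⊆ X ∧ (∀ μ ∈ Msigma X, μ C = 1) ∧
  ∀ Y : Set (ℕ → A), ShiftSpace Y → Y ⊆ X → (∀ μ ∈ Msigma X, μ Y = 1) → C ⊆ Y

/-- Measure of the cylinder determined by a word of length `n`. -/
noncomputable def cylMeasure (μ : ProbabilityMeasure (ℕ → A)) {n : ℕ} (w : Fin n → A) : ℝ :=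
  ((μ : Measure (ℕ → A)) {x | ∀ k : Fin n, x (k : ℕ) = w k}).toReal

/-- Entropy of the partition into cylinders of length `n`. -/
noncomputable def blockEntropy (μ : ProbabilityMeasure (ℕ → A)) (n : ℕ) : ℝ :=
  -∑ w : Fin n → A, cylMeasure μ w * Real.log (cylMeasure μ w)

/-- Kolmogorov–Sinai entropy of a shift-invariant measure. -/
noncomputable def ksEntropy (μ : ProbabilityMeasure (ℕ → A)) : ℝ :=
  Filter.limsup (fun n => blockEntropy μ n / (n : ℝ)) Filter.atTop

/-- `μ` is ergodic for the shift. -/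
def ErgodicPM (μ : ProbabilityMeasure (ℕ → A)) : Prop :=
  Ergodic shift (μ : Measure (ℕ → A))

/-- Ergodic measures are entropy dense in `M_σ(X)`. -/
def EntropyDense (X : Set (ℕ → A)) : Prop :=
  ∀ μ ∈ Msigma X, ∀ U : Set (ProbabilityMeasure (ℕ → A)), IsOpen U → μ ∈ U →
    ∀ ε : ℝ, 0 < ε →
      ∃ ν ∈ Msigma X, ν ∈ U ∧ ErgodicPM ν ∧ |ksEntropy ν - ksEntropy μ| < ε

/-- Topological entropy of a shift space. -/
noncomputable def topEntropy (X : Set (ℕ → A)) : ℝ :=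
  Filter.limsup (fun n => Real.log (Nat.card ↥(langN n X)) / (n : ℝ)) Filter.atTop

/-- The standard metric on the full shift. -/
noncomputable def rho (x y : ℕ → A) : ℝ :=
  open scoped Classical in
  if x = y then 0 else (2 : ℝ) ^ (-((sInf {j : ℕ | x j ≠ y j} : ℕ) : ℤ))

/-- Proximality of a shift space. -/
def ProximalShift (X : Set (ℕ → A)) : Prop :=
  ∀ x ∈ X, ∀ y ∈ X,
    Filter.liminf (fun n => rho (shift^[n] x) (shift^[n] y)) Filter.atTop = 0

/-- Minimality of a shift space. -/
def MinimalShift (X : Set (ℕ → A)) : Prop :=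
  ShiftSpace X ∧ ∀ Y : Set (ℕ → A), ShiftSpace Y → Y ⊆ X → Y = X

/-- An `A`-labeled directed multigraph on vertices `V` with edges `E`. -/
structure LabeledGraph (A V E : Type*) where
  src : E → V
  dst : E → V
  lab : E → A

namespace LabeledGraph

variable {A' V E : Type*}

/-- `es` is a path in `G` from `u` to `v`. -/
def PathFromTo (G : LabeledGraph A' V E) (es : List E) (u v : V) : Prop :=
  es.Chain' (fun e f => G.dst e = G.src f) ∧
  es.head?.map G.src = some u ∧ es.getLast?.map G.dst = some v

/-- `G` is strongly connected. -/
def StronglyConnected (G : LabeledGraph A' V E) : Prop :=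
  ∀ u v : V, ∃ es : List E, G.PathFromTo es u v

/-- `d` is the period of `G`: the gcd of lengths of closed paths. -/
def HasPeriod (G : LabeledGraph A' V E) (d : ℕ) : Prop :=
  (∀ (es : List E) (u : V), G.PathFromTo es u u → d ∣ es.length) ∧
  ∀ d' : ℕ, (∀ (es : List E) (u : V), G.PathFromTo es u u → d' ∣ es.length) → d' ∣ d

/-- `b` is a safe symbol for `G`. -/
def SafeSymbol (G : LabeledGraph A' V E) (b : A') : Prop :=
  ∀ e : E, ∃ e' : E, G.src e' = G.src e ∧ G.dst e' = G.dst e ∧ G.lab e' = b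

/-- The shift space presented by the labeled graph `G`: labels read along infinite paths. -/
def presents (G : LabeledGraph A' V E) : Set (ℕ → A') :=
  {x | ∃ e : ℕ → E, (∀ j, G.dst (e j) = G.src (e (j + 1))) ∧ ∀ j, x j = G.lab (e j)}

end LabeledGraph

/-- The coupling of a family of labeled graphs: an edge labeled `a` from `v` to `v'` exists
iff each `G k` has an edge from `v k` to `v' k` labeled `a`. -/
def coupling {A' : Type*} {n : ℕ} {V E : Fin n → Type*}
    (G : ∀ k, LabeledGraph A' (V k) (E k)) :
    LabeledGraph A' (∀ k, V k) {p : (∀ k, E k) × A' // ∀ k, (G k).lab (p.1 k) = p.2} where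
  src p := fun k => (G k).src (p.1.1 k)
  dst p := fun k => (G k).dst (p.1.1 k)
  lab p := p.1.2

/-- Sofic shift spaces: those presented by some finite labeled graph. -/
def Sofic (X : Set (ℕ → A)) : Prop :=
  ∃ (V E : Type) (_ : Fintype V) (_ : Fintype E) (G : LabeledGraph A V E),
    X = G.presents

/-- The coded shift generated by a finite set of words `B`: the closure of the set of all
shifts of infinite concatenations of words from `B`. -/
def codedShift (B : Finset (List A)) : Set (ℕ → A) :=
  closure {x | ∃ (b : ℕ → List A) (k : ℕ), (∀ i, b i ∈ B) ∧ x = shift^[k] (concatSeq b)}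


lemma continuous_shift : Continuous (shift : (ℕ → A) → (ℕ → A)) :=
  continuous_pi fun n => continuous_apply (n + 1)

lemma isClopen_cylNbhd (X : Set (ℕ → A)) (n : ℕ) : IsClopen (cylNbhd X n) :=
  (isClopen_discrete {w : Fin n → A | List.ofFn w ∈ lang X}).preimage
    (continuous_pi fun k => continuous_apply (k : ℕ))

lemma ofFn_mem_lang_iff {X : Set (ℕ → A)} {n : ℕ} {w : Fin n → A} :
    List.ofFn w ∈ lang X ↔ ∃ x ∈ X, ∃ i : ℕ, ∀ k : Fin n, w k = x (i + k) := by
  refine exists_congr fun x => and_congr_right fun _ => exists_congr fun i => ?_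
  rw [List.ext_getElem_iff]
  simp only [List.length_ofFn, List.getElem_ofFn, true_and]
  exact ⟨fun h k => h k k.2 k.2, fun h k hk _ => h ⟨k, hk⟩⟩

lemma markovApprox_subset_cylNbhd (X : Set (ℕ → A)) {m n : ℕ} (h : m ≤ n + 1) :
    markovApprox X n ⊆ cylNbhd X m := by
  intro x hx
  obtain ⟨y, hy, i, hi⟩ := ofFn_mem_lang_iff.1 (hx 0)
  exact ofFn_mem_lang_iff.2 ⟨y, hy, i, fun k => by simpa using hi (Fin.castLE h k)⟩

lemma shift_iterate_apply (x : ℕ → A) (i k : ℕ) : shift^[i] x k = x (i + k) := by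
  induction i generalizing x with
  | zero => simp
  | succ i ih =>
    rw [Function.iterate_succ_apply, ih]
    simp [shift, Nat.add_right_comm]

lemma iInter_cylNbhd_subset {X : Set (ℕ → A)} (hX : ShiftSpace X) :
    ⋂ n, cylNbhd X n ⊆ X := by
  intro x hx
  have key (n : ℕ) : ∃ y ∈ X, ∀ k < n, x k = y k := by
    obtain ⟨y, hy, i, hi⟩ := ofFn_mem_lang_iff.1 (Set.mem_iInter.1 hx n)
    refine ⟨shift^[i] y, Set.MapsTo.iterate (f := shift) hX.2.2 i hy, fun k hk => ?_⟩
    rw [shift_iterate_apply]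
    exact hi ⟨k, hk⟩
  choose y hyX hy using key
  refine hX.2.1.mem_of_tendsto (f := y) (b := atTop) ?_ (Eventually.of_forall hyX)
  refine tendsto_pi_nhds.2 fun k => tendsto_const_nhds.congr' ?_
  filter_upwards [eventually_gt_atTop k] with n hn using hy n k hn

lemma isClosed_setOf_invariantPM :
    IsClosed {μ : ProbabilityMeasure (ℕ → A) | invariantPM μ} := by
  have h : {μ : ProbabilityMeasure (ℕ → A) | invariantPM μ} =
      {μ | μ.map continuous_shift.measurable.aemeasurable = μ} :=
    Set.ext fun μ => (ProbabilityMeasure.toMeasure_injective.eq_iff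
      (a := μ.map continuous_shift.measurable.aemeasurable) (b := μ))
  rw [h]
  exact isClosed_eq (ProbabilityMeasure.continuous_map continuous_shift) continuous_id

/-- Weak* limit points of invariant measures carried by the Markov approximations of `X` are
invariant measures carried by `X`. -/
lemma mem_Msigma_of_mapClusterPt {X : Set (ℕ → A)} (hX : ShiftSpace X)
    {mu : ℕ → ProbabilityMeasure (ℕ → A)} (hmu : ∀ n, mu n ∈ Msigma (markovApprox X n))
    {μ : ProbabilityMeasure (ℕ → A)} (hμ : MapClusterPt μ atTop mu) : μ ∈ Msigma X := by
  obtain ⟨U, hU, hlim⟩ := mapClusterPt_iff_ultrafilter.1 hμ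
  refine ⟨isClosed_setOf_invariantPM.mem_of_tendsto hlim
    (Eventually.of_forall fun n => (hmu n).1), ?_⟩
  have hcyl (m : ℕ) : μ (cylNbhd X m) = 1 := by
    refine tendsto_nhds_unique
      (ProbabilityMeasure.tendsto_measure_of_isClopen_of_tendsto hlim (isClopen_cylNbhd X m))
      (tendsto_const_nhds.congr' (hU ?_))
    filter_upwards [eventually_ge_atTop m] with n hn
    refine le_antisymm ?_ ((mu n).apply_le_one _)
    rw [← (hmu n).2]
    exact (mu n).apply_mono (markovApprox_subset_cylNbhd X (by omega))
  have hae : ∀ᵐ x ∂(μ : Measure (ℕ → A)), ∀ m, x ∈ cylNbhd X m := by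
    refine ae_all_iff.2 fun m => ?_
    refine (mem_ae_iff_prob_eq_one (isClopen_cylNbhd X m).1.measurableSet).2 ?_
    change (μ : Measure (ℕ → A)) (cylNbhd X m) = 1
    rw [← ProbabilityMeasure.ennreal_coeFn_eq_coeFn_toMeasure, hcyl m, ENNReal.coe_one]
  have hXae : X ∈ ae (μ : Measure (ℕ → A)) := by
    filter_upwards [hae] with x hx using iInter_cylNbhd_subset hX (Set.mem_iInter.2 hx)
  rw [mem_ae_iff_prob_eq_one hX.2.1.measurableSet,
    ← ProbabilityMeasure.ennreal_coeFn_eq_coeFn_toMeasure] at hXae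
  exact_mod_cast hXae

lemma IsJoining.map_swap {ξ : Measure ((ℕ → A) × (ℕ → A))} {μ ν : ProbabilityMeasure (ℕ → A)}
    (h : IsJoining ξ μ ν) : IsJoining (ξ.map Prod.swap) ν μ := by
  have hs : Measurable (shift : (ℕ → A) → (ℕ → A)) := continuous_shift.measurable
  refine ⟨?_, ?_, ?_⟩
  · rw [Measure.map_map (hs.prodMap hs) measurable_swap]
    conv_rhs => rw [← h.1, Measure.map_map measurable_swap (hs.prodMap hs)]
    rfl
  · rw [Measure.map_map measurable_fst measurable_swap]
    exact h.2.2
  · rw [Measure.map_map measurable_snd measurable_swap]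
    exact h.2.1

lemma dbarM_comm (μ ν : ProbabilityMeasure (ℕ → A)) : dbarM μ ν = dbarM ν μ := by
  have key (μ ν : ProbabilityMeasure (ℕ → A)) (r : ℝ) :
      (∃ ξ : Measure ((ℕ → A) × (ℕ → A)),
        IsJoining ξ μ ν ∧ r = (ξ {p | p.1 0 ≠ p.2 0}).toReal) →
      ∃ ξ : Measure ((ℕ → A) × (ℕ → A)),
        IsJoining ξ ν μ ∧ r = (ξ {p | p.1 0 ≠ p.2 0}).toReal := by
    rintro ⟨ξ, hξ, rfl⟩
    refine ⟨ξ.map Prod.swap, hξ.map_swap, ?_⟩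
    have hswap : ξ.map Prod.swap {p | p.1 0 ≠ p.2 0} =
        ξ (Prod.swap ⁻¹' {p | p.1 0 ≠ p.2 0}) := MeasurableEquiv.prodComm.map_apply _
    rw [hswap]
    simp only [Set.preimage_setOf_eq, Prod.fst_swap, Prod.snd_swap, ne_comm]
  exact congrArg sInf (Set.ext fun r => ⟨key μ ν r, key ν μ r⟩)

lemma dbarM_nonneg (μ ν : ProbabilityMeasure (ℕ → A)) : 0 ≤ dbarM μ ν :=
  Real.sInf_nonneg <| by
    rintro _ ⟨ξ, -, rfl⟩
    exact ENNReal.toReal_nonneg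

/-- for an infinite strictly ergodic `d̄_M`-stable shift space, ergodic
measures on periodic orbits of the Markov approximations converge to the unique invariant
measure in `d̄_M`. -/
theorem statement7 (hA : 2 ≤ Fintype.card A) (X : Set (ℕ → A))
    (hinf : X.Infinite) (hmin : MinimalShift X)
    (nu : ProbabilityMeasure (ℕ → A)) (huniq : Msigma X = {nu})
    (hstab : DbarMStable X)
    (mu : ℕ → ProbabilityMeasure (ℕ → A))
    (hmu : ∀ n : ℕ, mu n ∈ Msigma (markovApprox X n) ∧ ErgodicPM (mu n) ∧
      ∃ (x : ℕ → A) (p : ℕ), 0 < p ∧ shift^[p] x = x ∧ x ∈ markovApprox X n ∧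
        mu n {y | ∃ k : ℕ, y = shift^[k] x} = 1) :
    Filter.Tendsto (fun n => dbarM (mu n) nu) Filter.atTop (nhds 0) := by
  have hlim : Tendsto mu atTop (𝓝 nu) := by
    refine tendsto_nhds_of_unique_mapClusterPt fun μ hμ => ?_
    have h := mem_Msigma_of_mapClusterPt hmin.1 (fun n => (hmu n).1) hμ
    rwa [huniq] at h
  refine (nhds_basis_Ioo_pos (0 : ℝ)).tendsto_right_iff.2 fun ε hε => ?_
  obtain ⟨U, hU, hXU, hstabU⟩ := hstab ε hε
  rw [huniq] at hXU hstabU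
  filter_upwards [hlim (hU.mem_nhds (hXU rfl))] with n hn
  obtain ⟨μ, rfl, hd⟩ := hstabU (mu n) hn (hmu n).1.1
  rw [dbarM_comm]
  exact ⟨by linarith [dbarM_nonneg μ (mu n)], by linarith⟩

end DbarPaper
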